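/- Let P be n independent uniform random points in [0,1]². Then with probability ≥ 1 − 1/n^{O(1)}, any set of lines separating P has size Ω(n^{2/3} log log n / log n). -/

import Mathlib

open MeasureTheory

def SepLine (ℓ : ℝ × ℝ × ℝ) (p q : ℝ × ℝ) : Prop :=
  (ℓ.1 * p.1 + ℓ.2.1 * p.2 + ℓ.2.2) * (ℓ.1 * q.1 + ℓ.2.1 * q.2 + ℓ.2.2) < 0

/-- The uniform probability measure on the unit square `[0,1]²`. -/
noncomputable def unifSq : Measure (ℝ × ℝ) :=
  volume.restrict (Set.Icc 0 1 ×ˢ Set.Icc 0 1)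

namespace SepAux

open Finset Classical

/-! ### Counting functions -/

section Counting
variable {n : ℕ} {C : Type} [Fintype C]

/-- A family of functions determined by values off `s` is small. -/
lemma count_le (s : Finset (Fin n)) (B : Finset (Fin n → C))
    (h : ∀ f ∈ B, ∀ f' ∈ B, (∀ i, i ∉ s → f i = f' i) → f = f') :
    B.card * Fintype.card C ^ s.card ≤ Fintype.card C ^ n := by
  have h1 : B.card ≤ Fintype.card ({i // i ∉ s} → C) := by
    rw [← Finset.card_univ]
    refine Finset.card_le_card_of_injOn (fun f i => f i.1) (by simp) ?_
    intro f hf f' hf' e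
    refine h f hf f' hf' fun i hi => ?_
    exact congrFun e ⟨i, hi⟩
  have h2 : Fintype.card {i // i ∉ s} = n - s.card := by
    rw [Fintype.card_subtype_compl]
    simp
  have h3 : s.card ≤ n := by simpa using Finset.card_le_univ s
  calc B.card * Fintype.card C ^ s.card
      ≤ Fintype.card C ^ (n - s.card) * Fintype.card C ^ s.card := by
        gcongr
        rw [Fintype.card_fun, h2] at h1
        exact h1
    _ = Fintype.card C ^ n := by rw [← pow_add]; congr 1; omega

lemma count_pair {i j : Fin n} (hij : i ≠ j) :
    ((univ : Finset (Fin n → C)).filter (fun f => f i = f j)).card * Fintype.card C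
      = Fintype.card C ^ n := by
  apply le_antisymm
  · have := count_le {j} ((univ : Finset (Fin n → C)).filter (fun f => f i = f j)) ?_
    · simpa using this
    · intro f hf f' hf' h
      simp only [mem_filter, mem_univ, true_and] at hf hf'
      funext k
      by_cases hk : k = j
      · subst hk
        rw [← hf, ← hf']
        exact h i (by simpa using hij)
      · exact h k (by simpa using hk)
  · have : (univ : Finset (Fin n → C)).card ≤
        (((univ : Finset (Fin n → C)).filter (fun f => f i = f j)) ×ˢ (univ : Finset C)).card := by
      refine Finset.card_le_card_of_injOn (fun f => (Function.update f j (f i), f j)) ?_ ?_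
      · intro f _
        simp [hij]
      · intro f _ f' _ e
        simp only [Prod.mk.injEq] at e
        funext k
        by_cases hk : k = j
        · rw [hk]; exact e.2
        · have := congrFun e.1 k
          simpa [hk] using this
    rw [Finset.card_product] at this
    simpa using this

lemma count_two {i j k l : Fin n} (hij : i < j) (hkl : k < l) (hne : (i, j) ≠ (k, l)) :
    ((univ : Finset (Fin n → C)).filter (fun f => f i = f j ∧ f k = f l)).card
      * Fintype.card C ^ 2 ≤ Fintype.card C ^ n := by
  have hij' := hij.ne
  have hkl' := hkl.ne
  by_cases hjl : j = l
  · subst hjl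
    have hik : i ≠ k := by rintro rfl; exact hne rfl
    have := count_le {j, i} ((univ : Finset (Fin n → C)).filter (fun f => f i = f j ∧ f k = f j)) ?_
    · rwa [Finset.card_pair hij'.symm] at this
    · intro f hf f' hf' h
      simp only [mem_filter, mem_univ, true_and] at hf hf'
      have hk := h k (by simp [hkl', hik.symm])
      funext m
      by_cases hm : m = j
      · subst hm; rw [← hf.2, ← hf'.2, hk]
      · by_cases hm' : m = i
        · subst hm'; rw [hf.1, hf'.1, ← hf.2, ← hf'.2, hk]
        · exact h m (by simp [hm, hm'])
  · have := count_le {j, l} ((univ : Finset (Fin n → C)).filter (fun f => f i = f j ∧ f k = f l)) ?_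
    · rwa [Finset.card_pair hjl] at this
    · intro f hf f' hf' h
      simp only [mem_filter, mem_univ, true_and] at hf hf'
      have key : f j = f' j ∧ f l = f' l := by
        by_cases hil : i = l
        · subst hil
          have hkj : k ≠ j := (hkl.trans hij).ne
          have hk := h k (by simp [hkl', hkj])
          refine ⟨?_, ?_⟩
          · rw [← hf.1, ← hf'.1, ← hf.2, ← hf'.2, hk]
          · rw [← hf.2, ← hf'.2, hk]
        · have hi := h i (by simp [hij', hil])
          have hj : f j = f' j := by rw [← hf.1, ← hf'.1, hi]
          refine ⟨hj, ?_⟩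
          by_cases hkj : k = j
          · subst hkj; rw [← hf.2, ← hf'.2, hj]
          · have hk := h k (by simp [hkj, hkl'])
            rw [← hf.2, ← hf'.2, hk]
      funext m
      by_cases hm : m = j
      · rw [hm]; exact key.1
      · by_cases hm' : m = l
        · rw [hm']; exact key.2
        · exact h m (by simp [hm, hm'])

/-- Number of colliding (unordered) pairs. -/
noncomputable def coll (f : Fin n → C) : ℕ :=
  ((univ : Finset (Fin n × Fin n)).filter (fun p => p.1 < p.2 ∧ f p.1 = f p.2)).card

/-- all pairs -/
noncomputable def prs (n : ℕ) : Finset (Fin n × Fin n) :=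
  (univ : Finset (Fin n × Fin n)).filter (fun p => p.1 < p.2)

lemma coll_eq (f : Fin n → C) :
    (coll f : ℝ) = ∑ p ∈ prs n, (if f p.1 = f p.2 then (1 : ℝ) else 0) := by
  rw [Finset.sum_boole, prs, Finset.filter_filter, coll]

lemma prs_card_ge : (n : ℝ) * (n - 1) / 2 ≤ (prs n).card := by
  have h : (univ : Finset (Fin n × Fin n)).card ≤
      ((prs n ∪ (prs n).image Prod.swap) ∪ (univ : Finset (Fin n)).image (fun i => (i, i))).card := by
    apply Finset.card_le_card
    rintro ⟨i, j⟩ -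
    simp only [prs, mem_union, mem_filter, mem_univ, true_and, mem_image, Prod.exists,
      Prod.swap_prod_mk, Prod.mk.injEq]
    rcases lt_trichotomy i j with h | h | h
    · left; left; exact h
    · right; exact ⟨i, rfl, h⟩
    · left; right; exact ⟨j, i, h, rfl, rfl⟩
  have h1 := Finset.card_union_le (prs n ∪ (prs n).image Prod.swap)
    ((univ : Finset (Fin n)).image (fun i => (i, i)))
  have h2 := Finset.card_union_le (prs n) ((prs n).image Prod.swap)
  have h3 : ((prs n).image Prod.swap).card ≤ (prs n).card := Finset.card_image_le
  have h4 : ((univ : Finset (Fin n)).image (fun i => (i, i))).card ≤ n := by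
    simpa using Finset.card_image_le (s := (univ : Finset (Fin n))) (f := fun i => (i, i))
  have h5 : (univ : Finset (Fin n × Fin n)).card = n * n := by simp
  have h6 : n * n ≤ 2 * (prs n).card + n := by omega
  have h7 : (n : ℝ) * n ≤ 2 * (prs n).card + n := by exact_mod_cast h6
  linarith

lemma chebyshev [Nonempty C] (hn : 0 < (prs n).card) :
    (((univ : Finset (Fin n → C)).filter
      (fun f => (coll f : ℝ) ≤ ((prs n).card / Fintype.card C : ℝ) / 2)).card : ℝ)
      * ((prs n).card / Fintype.card C : ℝ) ≤ 4 * (Fintype.card C : ℝ) ^ n := by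
  set q : ℝ := ((Fintype.card C : ℕ) : ℝ) with hq
  set M : ℝ := (((prs n).card : ℕ) : ℝ) with hM
  set μ : ℝ := M / q with hμ
  have hq0 : 0 < q := by rw [hq]; exact_mod_cast Fintype.card_pos
  have hM0 : 0 < M := by rw [hM]; exact_mod_cast hn
  have hμ0 : 0 < μ := div_pos hM0 hq0
  set Q : ℝ := q ^ n with hQ
  have hQ0 : 0 < Q := pow_pos hq0 n
  have e1 : ∀ p ∈ prs n, ∑ f : Fin n → C, (if f p.1 = f p.2 then (1 : ℝ) else 0) = Q / q := by
    intro p hp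
    have hp' : p.1 < p.2 := by simpa [prs] using hp
    rw [Finset.sum_boole, eq_div_iff hq0.ne']
    have := count_pair (C := C) hp'.ne
    rw [hq, hQ, hq]
    exact_mod_cast this
  have s1 : ∑ f : Fin n → C, (coll f : ℝ) = μ * Q := by
    simp_rw [coll_eq]
    rw [Finset.sum_comm, Finset.sum_congr rfl e1, Finset.sum_const, nsmul_eq_mul, hμ]
    ring
  have e2 : ∀ p ∈ prs n, ∀ p' ∈ prs n, ∑ f : Fin n → C, ((if f p.1 = f p.2 then (1 : ℝ) else 0) *
      (if f p'.1 = f p'.2 then (1 : ℝ) else 0)) ≤ Q / q ^ 2 + if p = p' then Q / q else 0 := by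
    intro p hp p' hp'
    by_cases h : p = p'
    · subst h
      rw [if_pos rfl, ← e1 p hp]
      have : 0 ≤ Q / q ^ 2 := by positivity
      have h2 : ∑ f : Fin n → C, ((if f p.1 = f p.2 then (1 : ℝ) else 0) *
        (if f p.1 = f p.2 then (1 : ℝ) else 0)) = ∑ f : Fin n → C, (if f p.1 = f p.2 then (1 : ℝ) else 0) := by
        apply Finset.sum_congr rfl
        intro f _
        split_ifs <;> simp
      linarith
    · rw [if_neg h, add_zero, le_div_iff₀ (by positivity)]
      have h1 : p.1 < p.2 := by simpa [prs] using hp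
      have h1' : p'.1 < p'.2 := by simpa [prs] using hp'
      have := count_two (C := C) h1 h1' h
      simp_rw [mul_ite, mul_one, mul_zero, ← ite_and]
      rw [Finset.sum_boole, hq, hQ, hq]
      have e : ((univ : Finset (Fin n → C)).filter (fun f => f p'.1 = f p'.2 ∧ f p.1 = f p.2)) =
        ((univ : Finset (Fin n → C)).filter (fun f => f p.1 = f p.2 ∧ f p'.1 = f p'.2)) := by
        ext f; simp [and_comm]
      rw [e]
      exact_mod_cast this
  have s2 : ∑ f : Fin n → C, (coll f : ℝ) ^ 2 ≤ (μ ^ 2 + μ) * Q := by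
    simp_rw [coll_eq, sq, Finset.sum_mul_sum]
    rw [Finset.sum_comm]
    calc _ = ∑ p ∈ prs n, ∑ p' ∈ prs n, ∑ f : Fin n → C, ((if f p.1 = f p.2 then (1 : ℝ) else 0) *
              (if f p'.1 = f p'.2 then (1 : ℝ) else 0)) := by
            apply Finset.sum_congr rfl
            intro p _
            rw [Finset.sum_comm]
      _ ≤ ∑ p ∈ prs n, ∑ p' ∈ prs n, (Q / q ^ 2 + if p = p' then Q / q else 0) :=
            Finset.sum_le_sum fun p hp => Finset.sum_le_sum fun p' hp' => e2 p hp p' hp'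
      _ = ∑ p ∈ prs n, (M * (Q / q ^ 2) + Q / q) := by
            apply Finset.sum_congr rfl
            intro p hp
            rw [Finset.sum_add_distrib, Finset.sum_const, nsmul_eq_mul, Finset.sum_ite_eq,
              if_pos hp]
      _ = (μ * μ + μ) * Q := by
            rw [Finset.sum_const, nsmul_eq_mul, ← hM, hμ]
            field_simp
  have s3 : ∑ f : Fin n → C, ((coll f : ℝ) - μ) ^ 2 ≤ μ * Q := by
    have : ∀ f : Fin n → C, ((coll f : ℝ) - μ) ^ 2 = (coll f : ℝ) ^ 2 - 2 * μ * coll f + μ ^ 2 :=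
      fun f => by ring
    simp_rw [this]
    rw [Finset.sum_add_distrib, Finset.sum_sub_distrib, ← Finset.mul_sum, s1, Finset.sum_const,
      nsmul_eq_mul]
    have : ((univ : Finset (Fin n → C)).card : ℝ) = Q := by simp [hQ, hq]
    rw [this]
    nlinarith
  set B := (univ : Finset (Fin n → C)).filter (fun f => (coll f : ℝ) ≤ μ / 2)
  have s4 : (B.card : ℝ) * (μ ^ 2 / 4) ≤ μ * Q := by
    calc (B.card : ℝ) * (μ ^ 2 / 4) = ∑ f ∈ B, μ ^ 2 / 4 := by
            rw [Finset.sum_const, nsmul_eq_mul]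
      _ ≤ ∑ f ∈ B, ((coll f : ℝ) - μ) ^ 2 := by
            apply Finset.sum_le_sum
            intro f hf
            have : (coll f : ℝ) ≤ μ / 2 := by simpa [B] using hf
            nlinarith
      _ ≤ ∑ f : Fin n → C, ((coll f : ℝ) - μ) ^ 2 :=
            Finset.sum_le_sum_of_subset_of_nonneg (Finset.subset_univ _) (fun _ _ _ => sq_nonneg _)
      _ ≤ μ * Q := s3
  have s5 : μ * ((B.card : ℝ) * μ) ≤ μ * (4 * Q) := by nlinarith
  exact le_of_mul_le_mul_left s5 hμ0

/-- five-fold collision -/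
noncomputable def bad5 (n : ℕ) (C : Type) [Fintype C] : Finset (Fin n → C) :=
  (univ : Finset (Fin n → C)).filter
    (fun f => ∃ t ∈ powersetCard 5 (univ : Finset (Fin n)), ∀ i ∈ t, ∀ j ∈ t, f i = f j)

lemma bad5_card : (bad5 n C).card * Fintype.card C ^ 4 ≤ n ^ 5 * Fintype.card C ^ n := by
  have h1 : bad5 n C ⊆ (powersetCard 5 (univ : Finset (Fin n))).biUnion
      (fun t => (univ : Finset (Fin n → C)).filter (fun f => ∀ i ∈ t, ∀ j ∈ t, f i = f j)) := by
    intro f hf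
    simp only [bad5, mem_filter, mem_univ, true_and] at hf
    simp only [mem_biUnion, mem_filter, mem_univ, true_and]
    exact hf
  calc (bad5 n C).card * Fintype.card C ^ 4
      ≤ (∑ t ∈ powersetCard 5 (univ : Finset (Fin n)),
        ((univ : Finset (Fin n → C)).filter (fun f => ∀ i ∈ t, ∀ j ∈ t, f i = f j)).card)
          * Fintype.card C ^ 4 := by
        gcongr
        exact (Finset.card_le_card h1).trans Finset.card_biUnion_le
    _ ≤ ∑ t ∈ powersetCard 5 (univ : Finset (Fin n)), Fintype.card C ^ n := by
        rw [Finset.sum_mul]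
        apply Finset.sum_le_sum
        intro t ht
        have htc : t.card = 5 := (mem_powersetCard.mp ht).2
        obtain ⟨a, ha⟩ : t.Nonempty := by rw [← Finset.card_pos]; omega
        have := count_le (t.erase a)
          ((univ : Finset (Fin n → C)).filter (fun f => ∀ i ∈ t, ∀ j ∈ t, f i = f j)) ?_
        · rwa [Finset.card_erase_of_mem ha, htc] at this
        · intro f hf f' hf' h
          simp only [mem_filter, mem_univ, true_and] at hf hf'
          funext k
          by_cases hk : k ∈ t
          · rw [hf k hk a ha, hf' k hk a ha]
            exact h a (by simp)
          · exact h k (by simp [hk])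
    _ ≤ n ^ 5 * Fintype.card C ^ n := by
        rw [Finset.sum_const, smul_eq_mul, card_powersetCard, Finset.card_univ, Fintype.card_fin]
        gcongr
        exact Nat.choose_le_pow n 5

/-- active cells -/
noncomputable def act (f : Fin n → C) : Finset C :=
  univ.filter (fun c => ∃ p : Fin n × Fin n, p.1 ≠ p.2 ∧ f p.1 = c ∧ f p.2 = c)

lemma coll_le (f : Fin n → C) (hf : f ∉ bad5 n C) : coll f ≤ 16 * (act f).card := by
  have hfib : ∀ c, ((univ : Finset (Fin n)).filter (fun i => f i = c)).card ≤ 4 := by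
    intro c
    by_contra hcon
    apply hf
    obtain ⟨t, ht, htc⟩ := Finset.exists_subset_card_eq
      (s := (univ : Finset (Fin n)).filter (fun i => f i = c)) (n := 5) (by omega)
    simp only [bad5, mem_filter, mem_univ, true_and]
    refine ⟨t, mem_powersetCard.mpr ⟨subset_univ _, htc⟩, fun i hi j hj => ?_⟩
    have h1 := ht hi
    have h2 := ht hj
    simp only [mem_filter, mem_univ, true_and] at h1 h2
    rw [h1, h2]
  have hsub : (univ : Finset (Fin n × Fin n)).filter (fun p => p.1 < p.2 ∧ f p.1 = f p.2) ⊆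
      (act f).biUnion (fun c => ((univ : Finset (Fin n)).filter (fun i => f i = c)) ×ˢ
        ((univ : Finset (Fin n)).filter (fun i => f i = c))) := by
    intro p hp
    simp only [mem_filter, mem_univ, true_and] at hp
    simp only [mem_biUnion, mem_product, mem_filter, mem_univ, true_and, act]
    exact ⟨f p.1, ⟨p, hp.1.ne, rfl, hp.2.symm⟩, rfl, hp.2.symm⟩
  calc coll f ≤ _ := Finset.card_le_card hsub
    _ ≤ ∑ c ∈ act f, _ := Finset.card_biUnion_le
    _ ≤ ∑ c ∈ act f, 16 := by
        apply Finset.sum_le_sum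
        intro c _
        rw [Finset.card_product]
        nlinarith [hfib c]
    _ = 16 * (act f).card := by rw [Finset.sum_const, smul_eq_mul, mul_comm]

/-- many active cells in `G` -/
noncomputable def badG (n : ℕ) (G : Finset C) (r : ℕ) : Finset (Fin n → C) :=
  (univ : Finset (Fin n → C)).filter (fun f => r ≤ (act f ∩ G).card)

lemma badG_card (G : Finset C) (r : ℕ) :
    (badG n G r).card * Fintype.card C ^ (2 * r) ≤
      G.card.choose r * (n * n) ^ r * Fintype.card C ^ n := by
  let D : (R : Finset C) → (R → Fin n × Fin n) → Finset (Fin n → C) := fun R h =>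
    (univ : Finset (Fin n → C)).filter
      (fun f => ∀ c : R, (h c).1 ≠ (h c).2 ∧ f (h c).1 = c ∧ f (h c).2 = c)
  have hD : ∀ R ∈ powersetCard r G, ∀ h : R → Fin n × Fin n,
      (D R h).card * Fintype.card C ^ (2 * r) ≤ Fintype.card C ^ n := by
    intro R hR h
    have hRc : R.card = r := (mem_powersetCard.mp hR).2
    rcases (D R h).eq_empty_or_nonempty with he | ⟨f₀, hf₀⟩
    · rw [he]; simp
    · simp only [D, mem_filter, mem_univ, true_and] at hf₀
      have hs : ((univ : Finset R).biUnion (fun c => {(h c).1, (h c).2})).card = 2 * r := by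
        rw [Finset.card_biUnion]
        · rw [Finset.sum_congr rfl (fun c _ => Finset.card_pair (hf₀ c).1)]
          simp [hRc, mul_comm]
        · intro c _ c' _ hcc
          rw [Function.onFun, Finset.disjoint_left]
          intro x hx hx'
          apply hcc
          have h1 : f₀ x = c := by
            simp only [mem_insert, mem_singleton] at hx
            rcases hx with rfl | rfl
            · exact (hf₀ c).2.1
            · exact (hf₀ c).2.2
          have h2 : f₀ x = c' := by
            simp only [mem_insert, mem_singleton] at hx'
            rcases hx' with rfl | rfl
            · exact (hf₀ c').2.1
            · exact (hf₀ c').2.2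
          exact Subtype.ext (h1.symm.trans h2)
      have := count_le ((univ : Finset R).biUnion (fun c => {(h c).1, (h c).2})) (D R h) ?_
      · rwa [hs] at this
      · intro f hf f' hf' hh
        simp only [D, mem_filter, mem_univ, true_and] at hf hf'
        funext k
        by_cases hk : k ∈ ((univ : Finset R).biUnion (fun c => {(h c).1, (h c).2}))
        · simp only [mem_biUnion, mem_univ, true_and, mem_insert, mem_singleton] at hk
          obtain ⟨c, rfl | rfl⟩ := hk
          · rw [(hf c).2.1, (hf' c).2.1]
          · rw [(hf c).2.2, (hf' c).2.2]
        · exact hh k hk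
  have hsub : badG n G r ⊆ (powersetCard r G).biUnion
      (fun R => (univ : Finset (R → Fin n × Fin n)).biUnion (D R)) := by
    intro f hf
    simp only [badG, mem_filter, mem_univ, true_and] at hf
    obtain ⟨R, hR, hRc⟩ := Finset.exists_subset_card_eq hf
    have hex : ∀ c : R, ∃ p : Fin n × Fin n, p.1 ≠ p.2 ∧ f p.1 = c ∧ f p.2 = c := by
      intro c
      have := hR c.2
      simp only [act, mem_inter, mem_filter, mem_univ, true_and] at this
      exact this.1
    choose h hh using hex
    simp only [mem_biUnion, mem_univ, true_and]
    refine ⟨R, mem_powersetCard.mpr ⟨hR.trans inter_subset_right, hRc⟩, h, ?_⟩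
    simp only [D, mem_filter, mem_univ, true_and]
    exact hh
  calc (badG n G r).card * Fintype.card C ^ (2 * r)
      ≤ (∑ R ∈ powersetCard r G, ∑ h : R → Fin n × Fin n, (D R h).card)
          * Fintype.card C ^ (2 * r) := by
        gcongr
        exact (Finset.card_le_card hsub).trans (Finset.card_biUnion_le.trans
          (Finset.sum_le_sum fun R _ => Finset.card_biUnion_le))
    _ ≤ ∑ R ∈ powersetCard r G, ∑ h : R → Fin n × Fin n, Fintype.card C ^ n := by
        rw [Finset.sum_mul]
        apply Finset.sum_le_sum
        intro R hR
        rw [Finset.sum_mul]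
        exact Finset.sum_le_sum fun h _ => hD R hR h
    _ = ∑ R ∈ powersetCard r G, (n * n) ^ r * Fintype.card C ^ n := by
        apply Finset.sum_congr rfl
        intro R hR
        rw [Finset.sum_const, smul_eq_mul, Finset.card_univ, Fintype.card_fun]
        simp [(mem_powersetCard.mp hR).2]
    _ = _ := by rw [Finset.sum_const, smul_eq_mul, card_powersetCard, mul_assoc]

end Counting

end SepAux
namespace SepAux

open Finset Classical

/-! ### Geometry -/

section Geometry
variable {N : ℕ}

/-- the closed grid cell -/
def cell (N : ℕ) (c : Fin N × Fin N) : Set (ℝ × ℝ) :=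
  Set.Icc ((c.1 : ℝ) / N) (((c.1 : ℝ) + 1) / N) ×ˢ Set.Icc ((c.2 : ℝ) / N) (((c.2 : ℝ) + 1) / N)

/-- discretized fattened line -/
noncomputable def strip (N : ℕ) (S T : ℤ) : Finset (Fin N × Fin N) :=
  univ.filter (fun c => |(N : ℤ) * ((c.2 : ℕ) - T) - S * (c.1 : ℕ)| ≤ 4 * N)

noncomputable def strip' (N : ℕ) (t : Bool × ℤ × ℤ) : Finset (Fin N × Fin N) :=
  if t.1 then (strip N t.2.1 t.2.2).image Prod.swap else strip N t.2.1 t.2.2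

lemma strip_card (hN : 0 < N) (S T : ℤ) : (strip N S T).card ≤ 9 * N := by
  have hN' : (0 : ℤ) < N := by exact_mod_cast hN
  have : (strip N S T).card ≤ ((univ : Finset (Fin N)) ×ˢ (Finset.Icc (-4 : ℤ) 4)).card := by
    refine Finset.card_le_card_of_injOn
      (fun c => (c.1, ((c.2 : ℕ) : ℤ) - ((N : ℤ) * T + S * (c.1 : ℕ)) / N)) ?_ ?_
    · intro c hc
      simp only [strip, coe_filter, mem_univ, true_and, Set.mem_ofPred_eq, abs_le] at hc
      simp only [coe_product, coe_univ, coe_Icc, Set.mem_prod, Set.mem_univ, true_and, Set.mem_Icc]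
      have h1 := Int.mul_ediv_self_le (x := (N : ℤ) * T + S * (c.1 : ℕ)) (k := N) hN'.ne'
      have h2 := Int.lt_mul_ediv_self_add (x := (N : ℤ) * T + S * (c.1 : ℕ)) (k := N) hN'
      set m := ((N : ℤ) * T + S * (c.1 : ℕ)) / N
      obtain ⟨h3, h4⟩ := hc
      constructor
      · by_contra hcon
        have : ((c.2 : ℕ) : ℤ) - m + 5 ≤ 0 := by omega
        nlinarith
      · by_contra hcon
        have : ((c.2 : ℕ) : ℤ) - m - 5 ≥ 0 := by omega
        nlinarith
    · rintro ⟨a, b⟩ _ ⟨a', b'⟩ _ h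
      simp only [Prod.mk.injEq] at h
      obtain ⟨rfl, h⟩ := h
      simp only [Prod.mk.injEq, true_and]
      apply Fin.ext
      omega
  rw [Finset.card_product] at this
  simpa [mul_comm] using this

lemma strip'_card (hN : 0 < N) (t : Bool × ℤ × ℤ) : (strip' N t).card ≤ 9 * N := by
  unfold strip'
  split_ifs
  · exact Finset.card_image_le.trans (strip_card hN _ _)
  · exact strip_card hN _ _

/-- the range of types of lines -/
noncomputable def box (N : ℕ) : Finset (Bool × ℤ × ℤ) :=
  univ ×ˢ (Finset.Icc (-(N : ℤ)) N ×ˢ Finset.Icc (-(6 * N : ℤ)) (6 * N))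

lemma box_card (hN : 0 < N) : (box N).card ≤ 78 * N ^ 2 := by
  have h1 : (Finset.Icc (-(N : ℤ)) N).card = 2 * N + 1 := by
    rw [Int.card_Icc]; omega
  have h2 : (Finset.Icc (-(6 * N : ℤ)) (6 * N)).card = 12 * N + 1 := by
    rw [Int.card_Icc]; omega
  rw [box, Finset.card_product, Finset.card_product, h1, h2]
  simp only [card_univ, Fintype.card_bool]
  nlinarith

lemma strip_T (hN : 0 < N) {S T : ℤ} (hS : |S| ≤ N) {c : Fin N × Fin N} (hc : c ∈ strip N S T) :
    |T| ≤ 6 * N := by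
  have hN' : (1 : ℤ) ≤ N := by exact_mod_cast hN
  simp only [strip, mem_filter, mem_univ, true_and] at hc
  have h1 : ((c.1 : ℕ) : ℤ) ≤ N := by exact_mod_cast c.1.2.le
  have h2 : ((c.2 : ℕ) : ℤ) ≤ N := by exact_mod_cast c.2.2.le
  have h1' : (0 : ℤ) ≤ ((c.1 : ℕ) : ℤ) := by positivity
  have h2' : (0 : ℤ) ≤ ((c.2 : ℕ) : ℤ) := by positivity
  have h3 : |S * ((c.1 : ℕ) : ℤ)| ≤ N * N := by
    rw [abs_mul, abs_of_nonneg h1']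
    exact mul_le_mul hS h1 h1' (by positivity)
  rw [abs_le] at *
  set u := S * ((c.1 : ℕ) : ℤ)
  set v := ((c.2 : ℕ) : ℤ)
  have hv : (N : ℤ) * v ≤ N * N := by nlinarith
  have hv' : 0 ≤ (N : ℤ) * v := by positivity
  have e : (N : ℤ) * (v - T) = N * v - N * T := by ring
  rw [e] at hc
  constructor
  · by_contra hcon
    have : (N : ℤ) * (T + 6 * N + 1) ≤ 0 := by nlinarith
    nlinarith
  · by_contra hcon
    have : (N : ℤ) * (T - 6 * N - 1) ≥ 0 := by nlinarith
    nlinarith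

lemma cross_strip {σ t X Y : ℝ} (hσ : |σ| ≤ 1) (c : Fin N × Fin N)
    (hX : (c.1 : ℝ) ≤ X) (hX' : X ≤ (c.1 : ℝ) + 1) (hY : (c.2 : ℝ) ≤ Y) (hY' : Y ≤ (c.2 : ℝ) + 1)
    (h : Y = σ * X + t) : c ∈ strip N ⌊σ * N⌋ ⌊t⌋ := by
  simp only [strip, mem_filter, mem_univ, true_and]
  have hS1 := Int.floor_le (σ * N)
  have hS2 := (Int.lt_floor_add_one (σ * N)).le
  have hT1 := Int.floor_le t
  have hT2 := (Int.lt_floor_add_one t).le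
  set S := ⌊σ * N⌋
  set T := ⌊t⌋
  have hi : ((c.1 : ℕ) : ℝ) ≤ N := by exact_mod_cast c.1.2.le
  have hi0 : (0 : ℝ) ≤ ((c.1 : ℕ) : ℝ) := by positivity
  have hN0 : (0 : ℝ) ≤ N := by positivity
  have key : |(N : ℝ) * (((c.2 : ℕ) : ℝ) - T) - S * ((c.1 : ℕ) : ℝ)| ≤ 4 * N := by
    set i := ((c.1 : ℕ) : ℝ)
    set j := ((c.2 : ℕ) : ℝ)
    have e : (N : ℝ) * (j - T) - S * i =
        N * (j - Y) + N * (t - T) + N * (σ * (X - i)) + (σ * N - S) * i := by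
      rw [h]; ring
    have b1 : |(N : ℝ) * (j - Y)| ≤ N := by
      rw [abs_mul, abs_of_nonneg hN0]
      exact mul_le_of_le_one_right hN0 (abs_le.mpr ⟨by linarith, by linarith⟩)
    have b2 : |(N : ℝ) * (t - T)| ≤ N := by
      rw [abs_mul, abs_of_nonneg hN0]
      exact mul_le_of_le_one_right hN0 (abs_le.mpr ⟨by linarith, by linarith⟩)
    have b3 : |(N : ℝ) * (σ * (X - i))| ≤ N := by
      rw [abs_mul, abs_of_nonneg hN0, abs_mul]
      refine mul_le_of_le_one_right hN0 (mul_le_one₀ hσ (abs_nonneg _) ?_)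
      exact abs_le.mpr ⟨by linarith, by linarith⟩
    have b4 : |(σ * N - S) * i| ≤ N := by
      rw [abs_mul, abs_of_nonneg hi0]
      have : |σ * N - S| ≤ 1 := abs_le.mpr ⟨by linarith, by linarith⟩
      nlinarith [abs_nonneg (σ * N - S)]
    rw [e]
    rw [abs_le] at *
    constructor <;> linarith [b1.1, b1.2, b2.1, b2.2, b3.1, b3.2, b4.1, b4.2]
  exact_mod_cast key

/-- type of a line -/
noncomputable def ltype (N : ℕ) (l : ℝ × ℝ × ℝ) : Bool × ℤ × ℤ :=
  if |l.1| ≤ |l.2.1| then (false, ⌊(-l.1 / l.2.1) * N⌋, ⌊(-l.2.2 / l.2.1) * N⌋)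
  else (true, ⌊(-l.2.1 / l.1) * N⌋, ⌊(-l.2.2 / l.1) * N⌋)

lemma exists_zero {l : ℝ × ℝ × ℝ} {p q : ℝ × ℝ} {c : Fin N × Fin N} (hp : p ∈ cell N c)
    (hq : q ∈ cell N c) (h : SepLine l p q) :
    ∃ x y, (x, y) ∈ cell N c ∧ l.1 * x + l.2.1 * y + l.2.2 = 0 := by
  unfold SepLine at h
  set u := l.1 * p.1 + l.2.1 * p.2 + l.2.2 with hu
  set v := l.1 * q.1 + l.2.1 * q.2 + l.2.2 with hv
  have hconv : Convex ℝ (cell N c) := (convex_Icc _ _).prod (convex_Icc _ _)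
  have huv : u - v ≠ 0 := by
    intro h0
    have : u = v := by linarith
    rw [this] at h
    nlinarith [mul_self_nonneg v]
  have ha : 0 ≤ -v / (u - v) := by
    rcases mul_neg_iff.mp h with h' | h'
    · apply div_nonneg <;> linarith
    · apply div_nonneg_of_nonpos <;> linarith
  have hb : 0 ≤ u / (u - v) := by
    rcases mul_neg_iff.mp h with h' | h'
    · apply div_nonneg <;> linarith
    · apply div_nonneg_of_nonpos <;> linarith
  have hab : -v / (u - v) + u / (u - v) = 1 := by
    field_simp; ring
  have := hconv hp hq ha hb hab
  refine ⟨_, _, this, ?_⟩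
  simp only [Prod.smul_fst, Prod.smul_snd, smul_eq_mul, Prod.fst_add, Prod.snd_add]
  set a := -v / (u - v) with ha'
  set b := u / (u - v) with hb'
  have : l.1 * (a * p.1 + b * q.1) + l.2.1 * (a * p.2 + b * q.2) + l.2.2
      = a * u + b * v + (1 - (a + b)) * l.2.2 := by rw [hu, hv]; ring
  rw [this, hab, ha', hb']
  field_simp
  ring

lemma sep_strip (hN : 0 < N) {l : ℝ × ℝ × ℝ} {p q : ℝ × ℝ} {c : Fin N × Fin N} (hp : p ∈ cell N c)
    (hq : q ∈ cell N c) (h : SepLine l p q) : c ∈ strip' N (ltype N l) ∧ ltype N l ∈ box N := by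
  have hN' : (0 : ℝ) < N := by exact_mod_cast hN
  obtain ⟨x, y, ⟨hx, hy⟩, hz⟩ := exists_zero hp hq h
  simp only [Set.mem_Icc] at hx hy
  rw [div_le_iff₀ hN', le_div_iff₀ hN'] at hx hy
  have hfl : ∀ σ : ℝ, |σ| ≤ 1 → |⌊σ * N⌋| ≤ (N : ℤ) := by
    intro σ hσ
    rw [abs_le] at *
    constructor
    · rw [Int.le_floor]; push_cast; nlinarith
    · have : (⌊σ * N⌋ : ℝ) ≤ N := (Int.floor_le _).trans (by nlinarith)
      exact_mod_cast this
  have main : ∀ σ t : ℝ, |σ| ≤ 1 → ∀ c' ∈ strip N ⌊σ * N⌋ ⌊t⌋, ∀ b : Bool,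
      (b, ⌊σ * N⌋, ⌊t⌋) ∈ box N := by
    intro σ t hσ c' hc' b
    have h1 := hfl σ hσ
    have h2 := strip_T hN h1 hc'
    simp only [box, mem_product, mem_univ, true_and, Finset.mem_Icc]
    exact ⟨abs_le.mp h1, abs_le.mp h2⟩
  by_cases hab : |l.1| ≤ |l.2.1|
  · have hb : l.2.1 ≠ 0 := by
      intro hb
      have ha : l.1 = 0 := by rw [hb, abs_zero] at hab; exact abs_nonpos_iff.mp hab
      unfold SepLine at h
      rw [ha, hb] at h
      nlinarith [mul_self_nonneg l.2.2]
    have hσ : |-l.1 / l.2.1| ≤ 1 := by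
      rw [abs_div, abs_neg]
      exact div_le_one_of_le₀ hab (abs_nonneg _)
    have hc := cross_strip (t := (-l.2.2 / l.2.1) * N) hσ c hx.1 hx.2 hy.1 hy.2 (by
      field_simp
      linear_combination hz)
    have e : ltype N l = (false, ⌊(-l.1 / l.2.1) * N⌋, ⌊(-l.2.2 / l.2.1) * N⌋) := by
      rw [ltype, if_pos hab]
    rw [e]
    refine ⟨?_, main _ _ hσ c hc _⟩
    simpa [strip'] using hc
  · have hb : l.1 ≠ 0 := by
      intro hb
      apply hab
      rw [hb, abs_zero]; exact abs_nonneg _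
    have hσ : |-l.2.1 / l.1| ≤ 1 := by
      rw [abs_div, abs_neg]
      exact div_le_one_of_le₀ (le_of_not_ge hab) (abs_nonneg _)
    have hc := cross_strip (t := (-l.2.2 / l.1) * N) hσ c.swap hy.1 hy.2 hx.1 hx.2 (by
      field_simp
      linear_combination hz)
    have e : ltype N l = (true, ⌊(-l.2.1 / l.1) * N⌋, ⌊(-l.2.2 / l.1) * N⌋) := by
      rw [ltype, if_neg hab]
    rw [e]
    refine ⟨?_, main _ _ hσ _ hc _⟩
    simp only [strip', if_true]
    exact mem_image.mpr ⟨c.swap, hc, Prod.swap_swap c⟩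

/-! ### Passing from measure to counting -/

lemma cell_vol (hN : 0 < N) (c : Fin N × Fin N) :
    unifSq (cell N c) ≤ ENNReal.ofReal (1 / (N : ℝ) ^ 2) := by
  have hN' : (0 : ℝ) < N := by exact_mod_cast hN
  refine (Measure.restrict_apply_le _ _).trans ?_
  rw [cell, Measure.volume_eq_prod, Measure.prod_prod, Real.volume_Icc, Real.volume_Icc,
    ← ENNReal.ofReal_mul (by rw [← sub_div]; simp)]
  apply ENNReal.ofReal_le_ofReal
  apply le_of_eq
  field_simp
  ring

lemma exists_idx (hN : 0 < N) {x : ℝ} (hx : x ∈ Set.Icc (0 : ℝ) 1) :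
    ∃ i : Fin N, x ∈ Set.Icc ((i : ℝ) / N) (((i : ℝ) + 1) / N) := by
  have hN' : (0 : ℝ) < N := by exact_mod_cast hN
  have h0 : 0 ≤ x * N := mul_nonneg hx.1 hN'.le
  by_cases h : x * N < N
  · refine ⟨⟨⌊x * N⌋₊, (Nat.floor_lt h0).mpr h⟩, ?_⟩
    rw [Set.mem_Icc, div_le_iff₀ hN', le_div_iff₀ hN']
    exact ⟨Nat.floor_le h0, (Nat.lt_floor_add_one _).le⟩
  · refine ⟨⟨N - 1, by omega⟩, ?_⟩
    rw [Set.mem_Icc, div_le_iff₀ hN', le_div_iff₀ hN']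
    have : ((N - 1 : ℕ) : ℝ) = N - 1 := by rw [Nat.cast_sub hN]; simp
    simp only [this]
    have : x * N ≤ N := by nlinarith [hx.2]
    constructor <;> linarith

instance : IsFiniteMeasure unifSq := by
  unfold unifSq
  refine ⟨?_⟩
  rw [Measure.restrict_apply_univ, Measure.volume_eq_prod, Measure.prod_prod]
  simp

lemma measure_le (hN : 0 < N) {n : ℕ} (B : Finset (Fin n → Fin N × Fin N))
    (E : Set (Fin n → ℝ × ℝ)) (h : ∀ ω ∈ E, ∀ f, (∀ i, ω i ∈ cell N (f i)) → f ∈ B) :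
    (Measure.pi fun _ : Fin n => unifSq) E ≤
      ENNReal.ofReal (B.card / ((N : ℝ) ^ 2) ^ n) := by
  have hN' : (0 : ℝ) < N := by exact_mod_cast hN
  have hsub : E ⊆ (⋃ f ∈ B, Set.pi Set.univ (fun i => cell N (f i))) ∪
      ⋃ i : Fin n, (fun ω : Fin n → ℝ × ℝ => ω i) ⁻¹' (Set.Icc 0 1 ×ˢ Set.Icc 0 1)ᶜ := by
    intro ω hω
    by_cases hall : ∀ i, ω i ∈ (Set.Icc (0 : ℝ) 1 ×ˢ Set.Icc (0 : ℝ) 1)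
    · left
      have : ∀ i, ∃ c : Fin N × Fin N, ω i ∈ cell N c := by
        intro i
        obtain ⟨a, ha⟩ := exists_idx hN (hall i).1
        obtain ⟨b, hb⟩ := exists_idx hN (hall i).2
        exact ⟨(a, b), ha, hb⟩
      choose f hf using this
      simp only [Set.mem_iUnion]
      exact ⟨f, h ω hω f hf, fun i _ => hf i⟩
    · right
      push Not at hall
      obtain ⟨i, hi⟩ := hall
      simp only [Set.mem_iUnion]
      exact ⟨i, hi⟩
  have hnull : (Measure.pi fun _ : Fin n => unifSq)
      (⋃ i : Fin n, (fun ω : Fin n → ℝ × ℝ => ω i) ⁻¹' (Set.Icc 0 1 ×ˢ Set.Icc 0 1)ᶜ) = 0 := by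
    rw [measure_iUnion_null_iff]
    intro i
    apply Measure.pi_eval_preimage_null
    unfold unifSq
    rw [Measure.restrict_apply (measurableSet_Icc.prod measurableSet_Icc).compl]
    simp
  calc _ ≤ _ := measure_mono hsub
    _ ≤ _ := measure_union_le _ _
    _ = (Measure.pi fun _ : Fin n => unifSq)
          (⋃ f ∈ B, Set.pi Set.univ (fun i => cell N (f i))) := by rw [hnull, add_zero]
    _ ≤ ∑ f ∈ B, (Measure.pi fun _ : Fin n => unifSq) (Set.pi Set.univ (fun i => cell N (f i))) :=
        measure_biUnion_finset_le _ _
    _ ≤ ∑ f ∈ B, ENNReal.ofReal (1 / (N : ℝ) ^ 2) ^ n := by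
        apply Finset.sum_le_sum
        intro f _
        rw [Measure.pi_pi]
        calc _ ≤ ∏ i : Fin n, ENNReal.ofReal (1 / (N : ℝ) ^ 2) :=
              Finset.prod_le_prod' fun i _ => cell_vol hN _
          _ = _ := by simp
    _ = _ := by
        rw [Finset.sum_const, nsmul_eq_mul, ← ENNReal.ofReal_pow (by positivity),
          ← ENNReal.ofReal_natCast, ← ENNReal.ofReal_mul (by positivity)]
        congr 1
        rw [div_pow, one_pow]; ring

end Geometry

end SepAux
namespace SepAux

open Finset Classical

/-! ### Assembly -/

/-- all bad discretized configurations -/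
noncomputable def bad (n N r : ℕ) : Finset (Fin n → Fin N × Fin N) :=
  ((univ : Finset (Fin n → Fin N × Fin N)).filter
      (fun f => (coll f : ℝ) ≤ ((prs n).card / Fintype.card (Fin N × Fin N) : ℝ) / 2)) ∪
    bad5 n (Fin N × Fin N) ∪ (box N).biUnion (fun t => badG n (strip' N t) r)

lemma mem_bad {n N r : ℕ} (hN : 0 < N) (L : Finset (ℝ × ℝ × ℝ)) (ω : Fin n → ℝ × ℝ)
    (hL : 16 * ((L.card : ℝ) * r) ≤ ((prs n).card / Fintype.card (Fin N × Fin N) : ℝ) / 2)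
    (hsep : ∀ i j : Fin n, i ≠ j → ∃ ℓ ∈ L, SepLine ℓ (ω i) (ω j))
    (f : Fin n → Fin N × Fin N) (hf : ∀ i, ω i ∈ cell N (f i)) : f ∈ bad n N r := by
  by_contra hcon
  simp only [bad, mem_union, not_or, mem_filter, mem_univ, true_and, mem_biUnion, not_exists,
    not_and, badG, not_le] at hcon
  obtain ⟨⟨h1, h2⟩, h3⟩ := hcon
  have h4 := coll_le f h2
  have hsub : act f ⊆ (L.filter (fun l => ltype N l ∈ box N)).biUnion
      (fun l => act f ∩ strip' N (ltype N l)) := by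
    intro c hc
    have hc' := hc
    simp only [act, mem_filter, mem_univ, true_and] at hc'
    obtain ⟨⟨i, j⟩, hij, hi, hj⟩ := hc'
    obtain ⟨l, hl, hs⟩ := hsep i j hij
    have hi' := hf i
    have hj' := hf j
    simp only at hi hj
    rw [hi] at hi'
    rw [hj] at hj'
    obtain ⟨ha, hb⟩ := sep_strip hN hi' hj' hs
    simp only [mem_biUnion, mem_filter, mem_inter]
    exact ⟨l, ⟨hl, hb⟩, hc, ha⟩
  have h5 : (act f).card ≤ L.card * r := by
    calc (act f).card ≤ _ := Finset.card_le_card hsub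
      _ ≤ ∑ l ∈ L.filter (fun l => ltype N l ∈ box N), (act f ∩ strip' N (ltype N l)).card :=
          Finset.card_biUnion_le
      _ ≤ ∑ l ∈ L.filter (fun l => ltype N l ∈ box N), r := by
          apply Finset.sum_le_sum
          intro l hl
          have := (h3 _ (mem_filter.mp hl).2).le
          convert this
      _ ≤ L.card * r := by
          rw [Finset.sum_const, smul_eq_mul]
          gcongr
          exact Finset.filter_subset _ _
  have h6 : (coll f : ℝ) ≤ 16 * ((L.card : ℝ) * r) := by exact_mod_cast h4.trans (by gcongr)
  linarith

lemma bad_card {n N r : ℕ} {x : ℝ} (hx : 2 ≤ x) (hn : (n : ℝ) = x ^ 3) (hN1 : x ^ 2 ≤ N)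
    (hN2 : (N : ℝ) ≤ 2 * x ^ 2) (hr : (9 : ℝ) ^ r / r.factorial ≤ 1 / x ^ 9) :
    x ^ 2 / 16 ≤ ((prs n).card / Fintype.card (Fin N × Fin N) : ℝ) ∧
    ((bad n N r).card : ℝ) / ((N : ℝ) ^ 2) ^ n ≤ 377 / x := by
  have hx0 : 0 < x := by linarith
  have hN0 : (0 : ℝ) < N := lt_of_lt_of_le (by positivity) hN1
  have hNp : 0 < N := by exact_mod_cast hN0
  have : Nonempty (Fin N × Fin N) := ⟨(⟨0, hNp⟩, ⟨0, hNp⟩)⟩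
  have hq : Fintype.card (Fin N × Fin N) = N ^ 2 := by simp [sq]
  have hn2 : (2 : ℝ) ≤ n := by rw [hn]; nlinarith [pow_le_pow_left₀ (by norm_num) hx 3]
  have hM : x ^ 6 / 4 ≤ ((prs n).card : ℝ) := by
    refine le_trans ?_ prs_card_ge
    have : x ^ 6 = (n : ℝ) * n := by rw [hn]; ring
    rw [this]; nlinarith
  have hMp : 0 < (prs n).card := by
    have : (0 : ℝ) < (prs n).card := lt_of_lt_of_le (by positivity) hM
    exact_mod_cast this
  have hμ : x ^ 2 / 16 ≤ ((prs n).card / Fintype.card (Fin N × Fin N) : ℝ) := by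
    rw [hq, le_div_iff₀ (by exact_mod_cast pow_pos hNp 2)]
    push_cast
    calc x ^ 2 / 16 * (N : ℝ) ^ 2 ≤ x ^ 2 / 16 * (2 * x ^ 2) ^ 2 := by gcongr
      _ = x ^ 6 / 4 := by ring
      _ ≤ _ := hM
  refine ⟨hμ, ?_⟩
  have hQ : (0 : ℝ) < ((N : ℝ) ^ 2) ^ n := by positivity
  set Q := ((N : ℝ) ^ 2) ^ n with hQd
  -- first part
  have c1 := chebyshev (C := Fin N × Fin N) hMp
  set B1 := (univ : Finset (Fin n → Fin N × Fin N)).filter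
      (fun f => (coll f : ℝ) ≤ ((prs n).card / Fintype.card (Fin N × Fin N) : ℝ) / 2) with hB1
  have b1 : (B1.card : ℝ) ≤ (64 / x ^ 2) * Q := by
    have e : ((Fintype.card (Fin N × Fin N) : ℕ) : ℝ) ^ n = Q := by rw [hq, hQd]; push_cast; rfl
    rw [e] at c1
    have : (B1.card : ℝ) * (x ^ 2 / 16) ≤ 4 * Q :=
      le_trans (mul_le_mul_of_nonneg_left hμ (by positivity)) c1
    rw [div_mul_eq_mul_div, le_div_iff₀ (by positivity)]
    linarith
  -- second part
  have b2 : ((bad5 n (Fin N × Fin N)).card : ℝ) ≤ (1 / x) * Q := by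
    have c2 := bad5_card (n := n) (C := Fin N × Fin N)
    rw [hq] at c2
    have c2' : ((bad5 n (Fin N × Fin N)).card : ℝ) * ((N : ℝ) ^ 2) ^ 4 ≤ (n : ℝ) ^ 5 * Q := by
      rw [hQd]; exact_mod_cast c2
    have h8 : (x ^ 2) ^ 8 ≤ (N : ℝ) ^ 8 := by gcongr
    have : ((bad5 n (Fin N × Fin N)).card : ℝ) * x ^ 16 ≤ x ^ 15 * Q := by
      calc _ ≤ ((bad5 n (Fin N × Fin N)).card : ℝ) * ((N : ℝ) ^ 2) ^ 4 := by
            gcongr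
            calc x ^ 16 = (x ^ 2) ^ 8 := by ring
              _ ≤ _ := h8
              _ = _ := by ring
        _ ≤ _ := c2'
        _ = _ := by rw [hn]; ring
    have h2 : x ^ 15 * (((bad5 n (Fin N × Fin N)).card : ℝ) * x) ≤ x ^ 15 * Q := by
      calc _ = ((bad5 n (Fin N × Fin N)).card : ℝ) * x ^ 16 := by ring
        _ ≤ _ := this
    have h3 := le_of_mul_le_mul_left h2 (by positivity)
    rw [div_mul_eq_mul_div, le_div_iff₀ (by positivity), one_mul]
    exact h3
  -- third part
  have b3 : ∀ t, ((badG n (strip' N t) r).card : ℝ) ≤ (1 / x ^ 9) * Q := by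
    intro t
    have c3 := badG_card (n := n) (strip' N t) r
    rw [hq] at c3
    have c3' : ((badG n (strip' N t) r).card : ℝ) * ((N : ℝ) ^ 2) ^ (2 * r) ≤
        ((strip' N t).card.choose r : ℝ) * ((n : ℝ) * n) ^ r * Q := by
      rw [hQd]; exact_mod_cast c3
    have hch : ((strip' N t).card.choose r : ℝ) ≤ (9 * N : ℝ) ^ r / r.factorial := by
      refine (Nat.choose_le_pow_div r _).trans ?_
      gcongr
      exact_mod_cast strip'_card hNp t
    have hN3 : (n : ℝ) * n ≤ (N : ℝ) ^ 3 := by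
      calc (n : ℝ) * n = (x ^ 2) ^ 3 := by rw [hn]; ring
        _ ≤ _ := by gcongr
    have hP : (0 : ℝ) < ((N : ℝ) ^ 2) ^ (2 * r) := by positivity
    have : ((badG n (strip' N t) r).card : ℝ) * ((N : ℝ) ^ 2) ^ (2 * r) ≤
        ((1 / x ^ 9) * Q) * ((N : ℝ) ^ 2) ^ (2 * r) := by
      calc _ ≤ _ := c3'
        _ ≤ (9 * N : ℝ) ^ r / r.factorial * ((N : ℝ) ^ 3) ^ r * Q := by gcongr
        _ = ((9 : ℝ) ^ r / r.factorial * Q) * ((N : ℝ) ^ 2) ^ (2 * r) := by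
            rw [mul_pow]
            have : (N : ℝ) ^ r * ((N : ℝ) ^ 3) ^ r = ((N : ℝ) ^ 2) ^ (2 * r) := by
              rw [← pow_mul, ← pow_mul, ← pow_add]; congr 1; ring
            rw [← this]; ring
        _ ≤ _ := by gcongr
    exact le_of_mul_le_mul_right this hP
  have b3' : (((box N).biUnion (fun t => badG n (strip' N t) r)).card : ℝ) ≤ (312 / x ^ 5) * Q := by
    calc (((box N).biUnion (fun t => badG n (strip' N t) r)).card : ℝ)
        ≤ ∑ t ∈ box N, ((badG n (strip' N t) r).card : ℝ) := by
          exact_mod_cast Finset.card_biUnion_le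
      _ ≤ ∑ t ∈ box N, (1 / x ^ 9) * Q := Finset.sum_le_sum fun t _ => b3 t
      _ = ((box N).card : ℝ) * ((1 / x ^ 9) * Q) := by rw [Finset.sum_const, nsmul_eq_mul]
      _ ≤ (78 * (N : ℝ) ^ 2) * ((1 / x ^ 9) * Q) := by
          gcongr
          exact_mod_cast box_card hNp
      _ ≤ (78 * (2 * x ^ 2) ^ 2) * ((1 / x ^ 9) * Q) := by gcongr
      _ = _ := by field_simp; ring
  have hu : ((bad n N r).card : ℝ) ≤ B1.card + (bad5 n (Fin N × Fin N)).card +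
      ((box N).biUnion (fun t => badG n (strip' N t) r)).card := by
    have h1 := Finset.card_union_le (B1 ∪ bad5 n (Fin N × Fin N))
      ((box N).biUnion (fun t => badG n (strip' N t) r))
    have h2 := Finset.card_union_le B1 (bad5 n (Fin N × Fin N))
    have h3 : (bad n N r).card ≤ B1.card + (bad5 n (Fin N × Fin N)).card +
      ((box N).biUnion (fun t => badG n (strip' N t) r)).card := by
      unfold bad
      rw [← hB1]
      omega
    exact_mod_cast h3
  rw [div_le_iff₀ hQ]
  have f1 : 64 / x ^ 2 ≤ 64 / x := by
    apply div_le_div_of_nonneg_left (by norm_num) hx0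
    nlinarith
  have f2 : 312 / x ^ 5 ≤ 312 / x := by
    apply div_le_div_of_nonneg_left (by norm_num) hx0
    exact le_self_pow₀ (by linarith) (by norm_num)
  have f3 : 64 / x + 1 / x + 312 / x = 377 / x := by ring
  calc ((bad n N r).card : ℝ) ≤ (64 / x ^ 2) * Q + (1 / x) * Q + (312 / x ^ 5) * Q := by linarith
    _ ≤ (64 / x) * Q + (1 / x) * Q + (312 / x) * Q := by gcongr
    _ = _ := by rw [← f3]; ring

lemma fact_bound {l : ℝ} (hll : 9 ≤ Real.log l) (hl : 1 ≤ l) {r : ℕ}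
    (hr : 16 * l / Real.log l ≤ r) : (9 : ℝ) ^ r / r.factorial ≤ Real.exp (-(3 * l)) := by
  have hl0 : 0 < l := by linarith
  set s := Real.sqrt l with hs
  have hs0 : 0 < s := Real.sqrt_pos.mpr hl0
  have hsl : s ≤ l := by
    rw [hs]; exact Real.sqrt_le_iff.mpr ⟨hl0.le, by nlinarith⟩
  have hlogs : Real.log s = Real.log l / 2 := Real.log_sqrt hl0.le
  have h1 : s ^ r / r.factorial ≤ Real.exp s := Real.pow_div_factorial_le_exp s hs0.le r
  have h9 : Real.log 9 ≤ 9 / 4 := by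
    have : Real.log 9 = 2 * Real.log 3 := by
      rw [show (9 : ℝ) = 3 ^ 2 by norm_num, Real.log_pow]; norm_num
    have h3 : Real.log 3 ≤ 9 / 8 := by
      rw [Real.log_le_iff_le_exp (by norm_num)]
      have := Real.exp_one_gt_d9
      have h := Real.add_one_le_exp (1 / 8 : ℝ)
      have e : Real.exp (9 / 8) = Real.exp 1 * Real.exp (1 / 8) := by
        rw [← Real.exp_add]; norm_num
      rw [e]
      nlinarith
    linarith
  have h2 : (9 / s) ^ r = Real.exp (r * (Real.log 9 - Real.log s)) := by
    rw [← Real.log_div (by norm_num) hs0.ne', Real.exp_nat_mul, Real.exp_log (by positivity)]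
  have hrr : 16 * l ≤ r * Real.log l := by
    rwa [div_le_iff₀ (by linarith)] at hr
  have hr0 : (0 : ℝ) ≤ r := by positivity
  calc (9 : ℝ) ^ r / r.factorial = (9 / s) ^ r * (s ^ r / r.factorial) := by
        rw [div_pow]; field_simp
    _ ≤ Real.exp (r * (Real.log 9 - Real.log s)) * Real.exp s := by
        rw [h2]; gcongr
    _ = Real.exp (r * (Real.log 9 - Real.log s) + s) := by rw [Real.exp_add]
    _ ≤ Real.exp (-(3 * l)) := by
        apply Real.exp_le_exp.mpr
        rw [hlogs]
        have : Real.log 9 - Real.log l / 2 ≤ - (Real.log l / 4) := by linarith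
        have : r * (Real.log 9 - Real.log l / 2) ≤ r * (-(Real.log l / 4)) := by gcongr
        nlinarith

end SepAux

/-- For `n` independent uniform random points in `[0,1]²`, with probability
`≥ 1 − 1/n^{O(1)}` every set of lines separating the points has size
`Ω(n^{2/3} log log n / log n)`: the probability that some separating set of fewer
than `β n^{2/3} log log n / log n` lines exists is at most `n^{-τ}`. -/
theorem stmt_17 :
    ∃ β τ : ℝ, 0 < β ∧ 0 < τ ∧ ∃ n₀ : ℕ, ∀ n ≥ n₀,
      (Measure.pi fun _ : Fin n => unifSq)
          {ω : Fin n → ℝ × ℝ | ∃ L : Finset (ℝ × ℝ × ℝ),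
            (L.card : ℝ) < β * (n : ℝ) ^ ((2 : ℝ) / 3) * Real.log (Real.log n) / Real.log n ∧
            ∀ i j : Fin n, i ≠ j → ∃ ℓ ∈ L, SepLine ℓ (ω i) (ω j)} ≤
        ENNReal.ofReal ((n : ℝ) ^ (-τ)) := by
  refine ⟨1 / 10000, 1 / 6, by norm_num, by norm_num, ?_⟩
  have hev : ∀ᶠ n : ℕ in Filter.atTop, 9 ≤ Real.log (Real.log n) ∧ 1 ≤ Real.log n ∧
      377 ≤ (n : ℝ) ^ ((1 : ℝ) / 6) := by
    have t1 : Filter.Tendsto (fun n : ℕ => Real.log n) Filter.atTop Filter.atTop :=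
      Real.tendsto_log_atTop.comp tendsto_natCast_atTop_atTop
    have t2 := Real.tendsto_log_atTop.comp t1
    have t3 : Filter.Tendsto (fun n : ℕ => (n : ℝ) ^ ((1 : ℝ) / 6)) Filter.atTop Filter.atTop :=
      (tendsto_rpow_atTop (by norm_num)).comp tendsto_natCast_atTop_atTop
    filter_upwards [t1.eventually_ge_atTop 1, t2.eventually_ge_atTop 9,
      t3.eventually_ge_atTop 377] with n h1 h2 h3
    exact ⟨h2, h1, h3⟩
  obtain ⟨n₀, hn₀⟩ := Filter.eventually_atTop.mp hev
  refine ⟨n₀, fun n hn => ?_⟩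
  obtain ⟨hll, hl, hy⟩ := hn₀ n hn
  set y : ℝ := (n : ℝ) ^ ((1 : ℝ) / 6) with hyd
  have hnn : (0 : ℝ) ≤ n := by positivity
  have hy0 : 0 < y := by linarith
  have hny : (n : ℝ) = (y ^ 2) ^ 3 := by
    rw [← pow_mul, hyd, ← Real.rpow_natCast, ← Real.rpow_mul hnn]; norm_num
  have hn23 : (n : ℝ) ^ ((2 : ℝ) / 3) = (y ^ 2) ^ 2 := by
    rw [← pow_mul, hyd, ← Real.rpow_natCast, ← Real.rpow_mul hnn]; norm_num
  have hnt : (n : ℝ) ^ (-((1 : ℝ) / 6)) = 1 / y := by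
    rw [Real.rpow_neg hnn, one_div y]
  set x : ℝ := y ^ 2 with hxd
  have hx : 2 ≤ x := by nlinarith
  have hx0 : 0 < x := by linarith
  have hnpos : (0 : ℝ) < n := by rw [hny]; positivity
  set l := Real.log n with hld
  set N := ⌈x ^ 2⌉₊ with hNd
  set r := ⌈16 * l / Real.log l⌉₊ with hrd
  have hN1 : x ^ 2 ≤ N := Nat.le_ceil _
  have hN2 : (N : ℝ) ≤ 2 * x ^ 2 := by
    have := (Nat.ceil_lt_add_one (show 0 ≤ x ^ 2 by positivity)).le
    nlinarith
  have hN0 : 0 < N := Nat.ceil_pos.mpr (by positivity)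
  have hr : 16 * l / Real.log l ≤ r := Nat.le_ceil _
  have hl0 : 0 < l := by linarith
  have hll0 : 0 < Real.log l := by linarith
  have hr2 : (r : ℝ) ≤ 17 * l / Real.log l := by
    have := (Nat.ceil_lt_add_one (show 0 ≤ 16 * l / Real.log l by positivity)).le
    have h1 : 1 ≤ l / Real.log l := by
      rw [le_div_iff₀ hll0, one_mul]
      exact Real.log_le_self hl0.le
    calc (r : ℝ) ≤ 16 * l / Real.log l + 1 := this
      _ ≤ 16 * l / Real.log l + l / Real.log l := by linarith
      _ = _ := by ring
  have hfac : (9 : ℝ) ^ r / r.factorial ≤ 1 / x ^ 9 := by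
    refine (SepAux.fact_bound hll hl hr).trans (le_of_eq ?_)
    rw [Real.exp_neg, one_div, show (3 : ℝ) * l = ((3 : ℕ) : ℝ) * l by norm_num,
      Real.exp_nat_mul, hld, Real.exp_log hnpos, hny]
    congr 1
    ring
  obtain ⟨hμ, hcard⟩ := SepAux.bad_card hx hny hN1 hN2 hfac
  refine (SepAux.measure_le hN0 (SepAux.bad n N r) _ ?_).trans ?_
  · rintro ω ⟨L, hLc, hsep⟩ f hf
    refine SepAux.mem_bad hN0 L ω ?_ hsep f hf
    rw [hn23] at hLc
    have : (L.card : ℝ) * r ≤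
        (1 / 10000 * x ^ 2 * Real.log l / l) * (17 * l / Real.log l) := by
      gcongr
    have e : (1 / 10000 * x ^ 2 * Real.log l / l) * (17 * l / Real.log l) = 17 / 10000 * x ^ 2 := by
      field_simp
    rw [e] at this
    nlinarith [sq_nonneg x]
  · apply ENNReal.ofReal_le_ofReal
    rw [hnt]
    refine hcard.trans ?_
    rw [div_le_div_iff₀ hx0 hy0, hxd]
    nlinarith
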